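/- (Theorem 2) Fix ε > 0 and δ ∈ (0,1), and suppose λ_u > (1/(π·R²))·log(2N/δ) and τ ≥ (1/(λ_r·g*))·log( 1 / (1 − (1/(λ_u·π·R²))·log(2N/δ)) ), where g* := 1 − exp(−2ε̄²) and ε̄ := R₀ε/(2BS). Then, under the hierarchical request model, with probability at least 1−δ the following holds: every Π̂* ∈ Δ_N that minimizes T(·,p̂) over Δ_N satisfies T(Π̂*,P) ≤ inf_{Π∈Δ_N} T(Π,P) + ε. -/

import Mathlib

open MeasureTheory

/-- `g(x) := exp(-μ_s(1-x)^M)`, the per-file miss factor. -/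
noncomputable def gmiss (μs : ℝ) (M : ℕ) (x : ℝ) : ℝ := Real.exp (-μs * (1 - x) ^ M)

/-- The probability simplex in `Fin N → ℝ`. -/
def simplexN (N : ℕ) : Set (Fin N → ℝ) := {c | (∀ i, 0 ≤ c i) ∧ ∑ i, c i = 1}

/-- Offloading loss `T(c,q) := (B/R₀)·Σ_i q_i·g(c_i)`. -/
noncomputable def offLoss (N : ℕ) (μs B R0 : ℝ) (M : ℕ) (c q : Fin N → ℝ) : ℝ :=
  (B / R0) * ∑ i, q i * gmiss μs M (c i)

/-- `S := sup_{c ∈ Δ_N} Σ_i g(c_i)`. -/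
noncomputable def Ssup (N : ℕ) (μs : ℝ) (M : ℕ) : ℝ :=
  sSup ((fun c => ∑ i, gmiss μs M (c i)) '' simplexN N)

/-- The empirical popularity profile computed from the first `n_p ω` requests
(`:= 0` when `n_p ω = 0`). -/
noncomputable def empProfile {Ω : Type*} (N : ℕ) (nP : Ω → ℕ) (X : ℕ → Ω → Fin N)
    (ω : Ω) (i : Fin N) : ℝ :=
  if nP ω = 0 then 0 else
    (1 / (nP ω : ℝ)) * ∑ l ∈ Finset.range (nP ω), if X l ω = i then (1 : ℝ) else 0

lemma aux_mgf (N : ℕ) (P : Fin N → ℝ) (hP : P ∈ simplexN N) (i : Fin N) (t : ℝ) :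
    ∑ a, P a * Real.exp (t * ((if a = i then (1 : ℝ) else 0) - P i)) ≤ Real.exp (t ^ 2 / 8) := by
  obtain ⟨h0, h1⟩ := hP
  have hsum : ∑ a, ENNReal.ofReal (P a) = 1 := by
    rw [← ENNReal.ofReal_sum_of_nonneg (fun a _ => h0 a), h1, ENNReal.ofReal_one]
  let p : PMF (Fin N) := PMF.ofFintype (fun a => ENNReal.ofReal (P a)) hsum
  have hint : ∀ f : Fin N → ℝ, ∫ a, f a ∂p.toMeasure = ∑ a, P a * f a := by
    intro f
    rw [PMF.integral_eq_sum]
    refine Finset.sum_congr rfl fun a _ => ?_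
    simp [p, PMF.ofFintype_apply, ENNReal.toReal_ofReal (h0 a)]
  have hs := ProbabilityTheory.hasSubgaussianMGF_of_mem_Icc (μ := p.toMeasure)
    (X := fun a => if a = i then (1 : ℝ) else 0) (a := 0) (b := 1)
    (measurable_of_finite _).aemeasurable
    (Filter.Eventually.of_forall fun a => by split_ifs <;> simp)
  have := hs.mgf_le t
  rw [ProbabilityTheory.mgf, hint, hint] at this
  simp only [mul_ite, mul_one, mul_zero, Finset.sum_ite_eq', Finset.mem_univ, if_true] at this
  refine this.trans (Real.exp_le_exp.2 (le_of_eq ?_))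
  simp
  ring

lemma aux_tail (N : ℕ) (P : Fin N → ℝ) (hP : P ∈ simplexN N) (i : Fin N) (e : ℝ) (he : 0 ≤ e)
    (n : ℕ) :
    ∑ y : Fin n → Fin N, (if (n : ℝ) * e ≤ |∑ l, ((if y l = i then (1 : ℝ) else 0) - P i)|
      then ∏ l, P (y l) else 0) ≤ 2 * Real.exp (-2 * e ^ 2) ^ n := by
  have key : ∀ t : ℝ, ∑ y : Fin n → Fin N, (∏ l, P (y l)) *
      Real.exp (t * (∑ l, ((if y l = i then (1 : ℝ) else 0) - P i)) - 4 * e * (n * e))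
      ≤ Real.exp (t ^ 2 / 8 - 4 * e ^ 2) ^ n := by
    intro t
    have h := aux_mgf N P hP i t
    have h2 : ∑ y : Fin n → Fin N, (∏ l, P (y l)) *
        Real.exp (t * (∑ l, ((if y l = i then (1 : ℝ) else 0) - P i)) - 4 * e * (n * e))
        = (∑ a, P a * Real.exp (t * ((if a = i then (1 : ℝ) else 0) - P i))) ^ n *
          Real.exp (-4 * e ^ 2) ^ n := by
      rw [Fintype.sum_pow, Finset.sum_mul]
      refine Finset.sum_congr rfl fun y _ => ?_
      rw [Finset.prod_mul_distrib, mul_assoc (∏ l, P (y l)), ← Real.exp_sum, ← Real.exp_nat_mul, ← Real.exp_add,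
        Finset.mul_sum]
      congr 2
      ring
    rw [h2, ← mul_pow]
    have h3 : Real.exp (t ^ 2 / 8 - 4 * e ^ 2) = Real.exp (t ^ 2 / 8) * Real.exp (-4 * e ^ 2) := by
      rw [← Real.exp_add]; congr 1; ring
    rw [h3]
    have : 0 ≤ ∑ a, P a * Real.exp (t * ((if a = i then (1 : ℝ) else 0) - P i)) :=
      Finset.sum_nonneg fun a _ => mul_nonneg (hP.1 a) (Real.exp_pos _).le
    gcongr
  have k1 := key (4 * e)
  have k2 := key (-(4 * e))
  have e1 : (4 * e) ^ 2 / 8 - 4 * e ^ 2 = -2 * e ^ 2 := by ring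
  have e2 : (-(4 * e)) ^ 2 / 8 - 4 * e ^ 2 = -2 * e ^ 2 := by ring
  rw [e1] at k1
  rw [e2] at k2
  rw [two_mul]
  refine le_trans ?_ (add_le_add k1 k2)
  rw [← Finset.sum_add_distrib]
  refine Finset.sum_le_sum fun y _ => ?_
  have hw : 0 ≤ ∏ l, P (y l) := Finset.prod_nonneg fun l _ => hP.1 _
  rw [← mul_add]
  set x := ∑ l, ((if y l = i then (1 : ℝ) else 0) - P i)
  split_ifs with hb
  · refine le_mul_of_one_le_right hw ?_
    rcases le_abs.1 hb with h | h
    · have : 1 ≤ Real.exp (4 * e * x - 4 * e * (n * e)) := by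
        apply Real.one_le_exp
        have := mul_le_mul_of_nonneg_left h (by positivity : 0 ≤ 4 * e)
        linarith
      have := Real.exp_pos (-(4 * e) * x - 4 * e * (n * e))
      linarith
    · have : 1 ≤ Real.exp (-(4 * e) * x - 4 * e * (n * e)) := by
        apply Real.one_le_exp
        have := mul_le_mul_of_nonneg_left h (by positivity : 0 ≤ 4 * e)
        linarith
      have := Real.exp_pos (4 * e * x - 4 * e * (n * e))
      linarith
  · positivity

/-- the bad event for a request sequence of length `n` -/
def auxBad (N : ℕ) (P : Fin N → ℝ) (e : ℝ) (n : ℕ) (y : Fin n → Fin N) : Prop :=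
  ∃ i, (n : ℝ) * e ≤ |∑ l, ((if y l = i then (1 : ℝ) else 0) - P i)|

open Classical in
lemma aux_union (N : ℕ) (P : Fin N → ℝ) (hP : P ∈ simplexN N) (e : ℝ) (he : 0 ≤ e) (n : ℕ) :
    ∑ y : Fin n → Fin N, (if auxBad N P e n y then ∏ l, ENNReal.ofReal (P (y l)) else 0)
      ≤ ENNReal.ofReal (2 * N * Real.exp (-2 * e ^ 2) ^ n) := by
  have hw : ∀ y : Fin n → Fin N, 0 ≤ ∏ l, P (y l) :=
    fun y => Finset.prod_nonneg fun l _ => hP.1 _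
  have h1 : ∀ y : Fin n → Fin N,
      (if auxBad N P e n y then ∏ l, ENNReal.ofReal (P (y l)) else 0)
      = ENNReal.ofReal (if auxBad N P e n y then ∏ l, P (y l) else 0) := by
    intro y
    split_ifs
    · rw [ENNReal.ofReal_prod_of_nonneg (fun l _ => hP.1 _)]
    · simp
  simp_rw [h1]
  rw [← ENNReal.ofReal_sum_of_nonneg (fun y _ => by split_ifs; exacts [hw y, le_rfl])]
  apply ENNReal.ofReal_le_ofReal
  calc _ ≤ ∑ y : Fin n → Fin N, ∑ i : Fin N,
        (if (n : ℝ) * e ≤ |∑ l, ((if y l = i then (1 : ℝ) else 0) - P i)|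
          then ∏ l, P (y l) else 0) := by
        refine Finset.sum_le_sum fun y _ => ?_
        have hnn : ∀ i ∈ Finset.univ, 0 ≤ 
          (if (n : ℝ) * e ≤ |∑ l, ((if y l = i then (1 : ℝ) else 0) - P i)|
          then ∏ l, P (y l) else 0) := by
          intro i _
          split_ifs
          exacts [hw y, le_rfl]
        split_ifs with hb
        · obtain ⟨i, hi⟩ := hb
          refine le_trans ?_ (Finset.single_le_sum hnn (Finset.mem_univ i))
          rw [if_pos hi]
        · exact Finset.sum_nonneg hnn
    _ = ∑ i : Fin N, ∑ y : Fin n → Fin N,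
        (if (n : ℝ) * e ≤ |∑ l, ((if y l = i then (1 : ℝ) else 0) - P i)|
          then ∏ l, P (y l) else 0) := Finset.sum_comm
    _ ≤ ∑ i : Fin N, 2 * Real.exp (-2 * e ^ 2) ^ n :=
        Finset.sum_le_sum fun i _ => aux_tail N P hP i e he n
    _ = _ := by simp; ring

lemma aux_tsum {f : ℕ → ℝ} {a : ℝ} (hf : ∀ n, 0 ≤ f n) (h : HasSum f a) :
    ∑' n, ENNReal.ofReal (f n) = ENNReal.ofReal a := by
  rw [← ENNReal.ofReal_tsum_of_nonneg hf h.summable, h.tsum_eq]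

lemma aux_pois (m x : ℝ) :
    HasSum (fun n : ℕ => Real.exp (-m) * m ^ n / (Nat.factorial n : ℝ) * x ^ n)
      (Real.exp (-m * (1 - x))) := by
  have h := (NormedSpace.expSeries_div_hasSum_exp (m * x)).mul_left (Real.exp (-m))
  rw [← Real.exp_eq_exp_ℝ, ← Real.exp_add] at h
  have e1 : -m + m * x = -m * (1 - x) := by ring
  rw [e1] at h
  refine h.congr_fun ?_
  intro n
  rw [mul_pow]; ring

lemma aux_prob {Ω : Type*} [MeasurableSpace Ω] (Pr : Measure Ω)
    (N : ℕ) (P : Fin N → ℝ) (hP : P ∈ simplexN N) (e : ℝ) (he : 0 ≤ e)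
    (m c : ℝ) (hm : 0 ≤ m) (hc : 0 ≤ c)
    (nR nP : Ω → ℕ) (X : ℕ → Ω → Fin N)
    (hjoint : ∀ k n : ℕ, Pr {ω | nR ω = k ∧ nP ω = n} =
      ENNReal.ofReal
        ((Real.exp (-m) * m ^ k / (Nat.factorial k : ℝ)) *
          (Real.exp (-((k : ℝ) * c)) * ((k : ℝ) * c) ^ n / (Nat.factorial n : ℝ))))
    (hcondiid : ∀ (n : ℕ) (y : Fin n → Fin N),
      Pr {ω | nP ω = n ∧ ∀ l : Fin n, X l ω = y l} =
        Pr {ω | nP ω = n} * ∏ l, ENNReal.ofReal (P (y l))) :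
    Pr {ω | auxBad N P e (nP ω) (fun l => X l ω)} ≤
      ENNReal.ofReal (2 * N * Real.exp (-m * (1 - Real.exp (-(c * (1 - Real.exp (-2 * e ^ 2))))))) := by
  classical
  set q := Real.exp (-2 * e ^ 2) with hq
  have hq0 : 0 < q := Real.exp_pos _
  calc Pr {ω | auxBad N P e (nP ω) (fun l => X l ω)}
      ≤ Pr (⋃ n, ⋃ y : Fin n → Fin N, if auxBad N P e n y then
          {ω | nP ω = n ∧ ∀ l : Fin n, X l ω = y l} else ∅) := by
        apply measure_mono
        intro ω hω
        refine Set.mem_iUnion.2 ⟨nP ω, Set.mem_iUnion.2 ⟨fun l => X l ω, ?_⟩⟩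
        rw [if_pos (show auxBad N P e (nP ω) (fun l => X l ω) from hω)]
        exact ⟨rfl, fun l => rfl⟩
    _ ≤ ∑' n, ∑ y : Fin n → Fin N, Pr (if auxBad N P e n y then
          {ω | nP ω = n ∧ ∀ l : Fin n, X l ω = y l} else ∅) := by
        refine (measure_iUnion_le _).trans (ENNReal.tsum_le_tsum fun n => ?_)
        refine (measure_iUnion_le _).trans ?_
        rw [tsum_fintype]
    _ = ∑' n, Pr {ω | nP ω = n} * ∑ y : Fin n → Fin N,
          (if auxBad N P e n y then ∏ l, ENNReal.ofReal (P (y l)) else 0) := by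
        refine tsum_congr fun n => ?_
        rw [Finset.mul_sum]
        refine Finset.sum_congr rfl fun y _ => ?_
        split_ifs
        · exact hcondiid n y
        · simp
    _ ≤ ∑' n, (∑' k, Pr {ω | nR ω = k ∧ nP ω = n}) * ENNReal.ofReal (2 * N * q ^ n) := by
        refine ENNReal.tsum_le_tsum fun n => ?_
        refine mul_le_mul' ?_ (aux_union N P hP e he n)
        refine le_trans (measure_mono ?_) (measure_iUnion_le _)
        intro ω hω
        exact Set.mem_iUnion.2 ⟨nR ω, rfl, hω⟩
    _ = ∑' k, ∑' n, ENNReal.ofReal ((2 * N * (Real.exp (-m) * m ^ k / (Nat.factorial k : ℝ))) *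
          (Real.exp (-((k : ℝ) * c)) * ((k : ℝ) * c) ^ n / (Nat.factorial n : ℝ) * q ^ n)) := by
        simp_rw [← ENNReal.tsum_mul_right]
        rw [ENNReal.tsum_comm]
        refine tsum_congr fun k => tsum_congr fun n => ?_
        rw [hjoint, ← ENNReal.ofReal_mul (by positivity)]
        congr 1
        ring
    _ = ∑' k, ENNReal.ofReal (2 * N * (Real.exp (-m) * m ^ k / (Nat.factorial k : ℝ) *
          Real.exp (-(c * (1 - q))) ^ k)) := by
        refine tsum_congr fun k => ?_
        rw [aux_tsum (fun n => by positivity) ((aux_pois ((k : ℝ) * c) q).mul_left _)]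
        congr 1
        rw [← Real.exp_nat_mul]
        have : -((k : ℝ) * c) * (1 - q) = k * -(c * (1 - q)) := by ring
        rw [this]
        ring
    _ = _ := by
        rw [aux_tsum (fun n => by positivity) ((aux_pois m _).mul_left _)]

lemma aux_g (μs : ℝ) (hμs : 0 < μs) (M : ℕ) (x : ℝ) (hx : x ≤ 1) :
    0 < gmiss μs M x ∧ gmiss μs M x ≤ 1 := by
  refine ⟨Real.exp_pos _, Real.exp_le_one_iff.2 ?_⟩
  have : 0 ≤ (1 - x) ^ M := pow_nonneg (by linarith) _
  nlinarith

lemma aux_le_one {N : ℕ} {c : Fin N → ℝ} (hc : c ∈ simplexN N) (i : Fin N) : c i ≤ 1 := by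
  rw [← hc.2]
  exact Finset.single_le_sum (fun j _ => hc.1 j) (Finset.mem_univ i)

lemma aux_S (N : ℕ) (μs : ℝ) (hμs : 0 < μs) (M : ℕ) {c : Fin N → ℝ} (hc : c ∈ simplexN N) :
    ∑ i, gmiss μs M (c i) ≤ Ssup N μs M := by
  refine le_csSup ⟨N, ?_⟩ ⟨c, hc, rfl⟩
  rintro _ ⟨d, hd, rfl⟩
  calc ∑ i, gmiss μs M (d i) ≤ ∑ i : Fin N, (1 : ℝ) :=
        Finset.sum_le_sum fun i _ => (aux_g μs hμs M _ (aux_le_one hd i)).2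
    _ = N := by simp

lemma aux_diff (N : ℕ) (μs B R0 : ℝ) (hμs : 0 < μs) (hB : 0 < B) (hR0 : 0 < R0) (M : ℕ)
    (p q : Fin N → ℝ) (e : ℝ) (he : 0 ≤ e) (h : ∀ i, |p i - q i| ≤ e)
    {c : Fin N → ℝ} (hc : c ∈ simplexN N) :
    offLoss N μs B R0 M c p ≤ offLoss N μs B R0 M c q + B / R0 * (e * Ssup N μs M) := by
  unfold offLoss
  rw [← mul_add]
  refine mul_le_mul_of_nonneg_left ?_ (by positivity)
  refine le_trans ?_ (add_le_add_right (mul_le_mul_of_nonneg_left (aux_S N μs hμs M hc) he) _)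
  rw [Finset.mul_sum, ← Finset.sum_add_distrib]
  refine Finset.sum_le_sum fun i _ => ?_
  rw [← add_mul]
  refine mul_le_mul_of_nonneg_right ?_ (Real.exp_pos _).le
  have := (abs_le.1 (h i)).2
  linarith

/-- Theorem 2: under the hierarchical request model, if
`λ_u > (1/(πR²))·log(2N/δ)` and
`τ ≥ (1/(λ_r g*))·log(1/(1 - (1/(λ_u π R²))·log(2N/δ)))` with
`g* := 1 - exp(-2ε̄²)`, `ε̄ := R₀ε/(2BS)`, then with probability at least `1-δ`,
every minimizer `ĉ` of `T(·,p̂)` over the simplex satisfies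
`T(ĉ,P) ≤ inf_{c ∈ Δ_N} T(c,P) + ε`. -/
theorem theorem2 (N : ℕ) (hN : 1 ≤ N) (μs B R0 : ℝ)
    (hμs : 0 < μs) (hB : 0 < B) (hR0 : 0 < R0) (M : ℕ) (hM : 1 ≤ M)
    (P : Fin N → ℝ) (hP : P ∈ simplexN N)
    (lamU lamR R τ ε δ : ℝ) (hlamU : 0 < lamU) (hlamR : 0 < lamR) (hR : 0 < R)
    (hτ0 : 0 ≤ τ) (hε : 0 < ε) (hδ0 : 0 < δ) (hδ1 : δ < 1)
    {Ω : Type*} [MeasurableSpace Ω] (Pr : Measure Ω) [IsProbabilityMeasure Pr]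
    (nR nP : Ω → ℕ) (X : ℕ → Ω → Fin N) (hX : ∀ l, Measurable (X l))
    (hjoint : ∀ k n : ℕ, Pr {ω | nR ω = k ∧ nP ω = n} =
      ENNReal.ofReal
        ((Real.exp (-(lamU * Real.pi * R ^ 2)) * (lamU * Real.pi * R ^ 2) ^ k /
            (Nat.factorial k : ℝ)) *
          (Real.exp (-((k : ℝ) * (lamR * τ))) * ((k : ℝ) * (lamR * τ)) ^ n /
            (Nat.factorial n : ℝ))))
    (hcondiid : ∀ (n : ℕ) (y : Fin n → Fin N),
      Pr {ω | nP ω = n ∧ ∀ l : Fin n, X l ω = y l} =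
        Pr {ω | nP ω = n} * ∏ l, ENNReal.ofReal (P (y l)))
    (hlamU' : (1 / (Real.pi * R ^ 2)) * Real.log (2 * N / δ) < lamU)
    (hτ : (1 / (lamR * (1 - Real.exp (-2 * (R0 * ε / (2 * B * Ssup N μs M)) ^ 2)))) *
        Real.log (1 / (1 - (1 / (lamU * Real.pi * R ^ 2)) * Real.log (2 * N / δ))) ≤ τ) :
    ENNReal.ofReal (1 - δ) ≤
      Pr {ω | ∀ chat ∈ simplexN N,
        (∀ c' ∈ simplexN N,
          offLoss N μs B R0 M chat (empProfile N nP X ω) ≤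
            offLoss N μs B R0 M c' (empProfile N nP X ω)) →
        offLoss N μs B R0 M chat P ≤
          sInf ((fun c => offLoss N μs B R0 M c P) '' simplexN N) + ε} := by
  have hSpos : 0 < Ssup N μs M := by
    have : Nonempty (Fin N) := ⟨⟨0, hN⟩⟩
    exact lt_of_lt_of_le (Finset.sum_pos (fun i _ => Real.exp_pos _) Finset.univ_nonempty)
      (aux_S N μs hμs M hP)
  set e := R0 * ε / (2 * B * Ssup N μs M) with hedef
  have he : 0 < e := by positivity
  have heS : B / R0 * (e * Ssup N μs M) = ε / 2 := by
    rw [hedef]; field_simp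
  have hm : 0 < lamU * Real.pi * R ^ 2 := by have := Real.pi_pos; positivity
  have hbad := aux_prob Pr N P hP e he.le (lamU * Real.pi * R ^ 2) (lamR * τ) hm.le
    (by positivity) nR nP X hjoint hcondiid
  have hNr : (1 : ℝ) ≤ N := by exact_mod_cast hN
  have hnum : 2 * N * Real.exp (-(lamU * Real.pi * R ^ 2) *
      (1 - Real.exp (-((lamR * τ) * (1 - Real.exp (-2 * e ^ 2)))))) ≤ δ := by
    set m := lamU * Real.pi * R ^ 2 with hmdef
    set L := Real.log (2 * N / δ) with hL
    have hLm : L < m := by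
      have hpi : 0 < Real.pi * R ^ 2 := by have := Real.pi_pos; positivity
      rw [one_div, inv_mul_lt_iff₀ hpi] at hlamU'
      rw [hmdef]; linarith
    have hg : 0 < 1 - Real.exp (-2 * e ^ 2) := by
      have : Real.exp (-2 * e ^ 2) < 1 := Real.exp_lt_one_iff.2 (by nlinarith [sq_pos_of_pos he])
      linarith
    have hx : 0 < 1 - 1 / m * L := by
      have : 1 / m * L < 1 := by rw [one_div, inv_mul_lt_iff₀ hm]; linarith
      linarith
    rw [one_div, inv_mul_le_iff₀ (by positivity), one_div, Real.log_inv] at hτ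
    have h1 : Real.exp (-((lamR * τ) * (1 - Real.exp (-2 * e ^ 2)))) ≤ 1 - 1 / m * L := by
      rw [← Real.le_log_iff_exp_le hx]
      linarith
    have h2 : L ≤ m * (1 - Real.exp (-((lamR * τ) * (1 - Real.exp (-2 * e ^ 2))))) := by
      have h3 : m * (1 / m * L) = L := by field_simp
      rw [← h3]
      exact mul_le_mul_of_nonneg_left (by linarith) hm.le
    have h4 : Real.exp (-m * (1 - Real.exp (-((lamR * τ) * (1 - Real.exp (-2 * e ^ 2))))))
        ≤ Real.exp (-L) := Real.exp_le_exp.2 (by linarith)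
    have h5 : Real.exp (-L) = δ / (2 * N) := by
      rw [Real.exp_neg, hL, Real.exp_log (by positivity), inv_div]
    calc _ ≤ 2 * N * (δ / (2 * N)) := by rw [← h5]; gcongr
      _ = δ := by field_simp
  have hbad' := hbad.trans (ENNReal.ofReal_le_ofReal hnum)
  set G := {ω | ∀ chat ∈ simplexN N,
        (∀ c' ∈ simplexN N,
          offLoss N μs B R0 M chat (empProfile N nP X ω) ≤
            offLoss N μs B R0 M c' (empProfile N nP X ω)) →
        offLoss N μs B R0 M chat P ≤
          sInf ((fun c => offLoss N μs B R0 M c P) '' simplexN N) + ε} with hG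
  have hcover : (Set.univ : Set Ω) ⊆ G ∪ {ω | auxBad N P e (nP ω) (fun l => X l ω)} := by
    intro ω _
    by_cases hb : auxBad N P e (nP ω) (fun l => X l ω)
    · exact Or.inr hb
    left
    intro chat hchat hmin
    have hgood : ∀ i, |empProfile N nP X ω i - P i| ≤ e := by
      intro i
      have hi : |∑ l : Fin (nP ω), ((if X l ω = i then (1 : ℝ) else 0) - P i)| < nP ω * e := by
        by_contra hcon
        exact hb ⟨i, not_lt.1 hcon⟩
      have hn : nP ω ≠ 0 := by
        intro h0
        have := (abs_nonneg _).trans_lt hi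
        rw [h0] at this
        simp at this
      have hnr : (0 : ℝ) < nP ω := by exact_mod_cast Nat.pos_of_ne_zero hn
      have heq : (nP ω : ℝ) * (empProfile N nP X ω i - P i) =
          ∑ l : Fin (nP ω), ((if X l ω = i then (1 : ℝ) else 0) - P i) := by
        rw [empProfile, if_neg hn, Finset.sum_sub_distrib,
          ← Fin.sum_univ_eq_sum_range (fun l => if X l ω = i then (1 : ℝ) else 0)]
        simp only [Finset.sum_const, Finset.card_univ, Fintype.card_fin, nsmul_eq_mul]
        field_simp
      rw [← heq, abs_mul, abs_of_pos hnr] at hi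
      exact (lt_of_mul_lt_mul_left hi hnr.le).le
    have hgood' : ∀ i, |P i - empProfile N nP X ω i| ≤ e := fun i => by
      rw [abs_sub_comm]; exact hgood i
    have : offLoss N μs B R0 M chat P - ε ≤
        sInf ((fun c => offLoss N μs B R0 M c P) '' simplexN N) := by
      refine le_csInf ⟨_, P, hP, rfl⟩ ?_
      rintro _ ⟨c, hc, rfl⟩
      have a1 := aux_diff N μs B R0 hμs hB hR0 M _ _ e he.le hgood' hchat
      have a2 := aux_diff N μs B R0 hμs hB hR0 M _ _ e he.le hgood hc
      have a3 := hmin c hc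
      rw [heS] at a1 a2
      dsimp only
      linarith
    linarith
  have htot : 1 ≤ Pr G + ENNReal.ofReal δ := by
    calc (1 : ENNReal) = Pr Set.univ := measure_univ.symm
      _ ≤ _ := measure_mono hcover
      _ ≤ _ := measure_union_le _ _
      _ ≤ _ := by gcongr
  rw [ENNReal.ofReal_sub _ hδ0.le, ENNReal.ofReal_one]
  exact tsub_le_iff_right.2 htot
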